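/- Let Γ be the free product (ℤ/2ℤ × ℤ/2ℤ) * (ℤ/2ℤ), with R0 and R2 the images of (1,0) and (0,1) from the first free factor and R1 the image of the generator of the second free factor. Set S1 = R2 and S = R0·R1. Then S1 has order 2, S has infinite order, the canonical homomorphism from the free product (ℤ/2ℤ) * ℤ to Γ sending the generator of the first factor to S1 and the generator 1 of ℤ to S is injective, and its image (the subgroup of Γ generated by S1 and S) has index 2 in Γ. -/

import Mathlib

/-- `Γ` is the free product `(ℤ/2ℤ × ℤ/2ℤ) ∗ (ℤ/2ℤ)` underlying the algebraic theory of maps. -/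
abbrev Γ : Type := Monoid.Coprod (Multiplicative (ZMod 2 × ZMod 2)) (Multiplicative (ZMod 2))

/-- `R0` is the image of `(1,0)` from the first free factor. -/
def R0 : Γ := Monoid.Coprod.inl (Multiplicative.ofAdd ((1, 0) : ZMod 2 × ZMod 2))

/-- `R1` is the image of the generator of the second free factor. -/
def R1 : Γ := Monoid.Coprod.inr (Multiplicative.ofAdd (1 : ZMod 2))

/-- `R2` is the image of `(0,1)` from the first free factor. -/
def R2 : Γ := Monoid.Coprod.inl (Multiplicative.ofAdd ((0, 1) : ZMod 2 × ZMod 2))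

/-- Homomorphisms out of the cyclic group of order two are determined on its generator. -/
theorem involutionHom_ext {M : Type*} [Monoid M] {f g : Multiplicative (ZMod 2) →* M}
    (h : f (Multiplicative.ofAdd 1) = g (Multiplicative.ofAdd 1)) : f = g := by
  refine MonoidHom.ext fun x => ?_
  obtain rfl | rfl : x = 1 ∨ x = Multiplicative.ofAdd 1 := by revert x; decide
  · simp
  · exact h

/-- Homomorphisms out of `Γ` are determined by their values on `R0`, `R1` and `R2`. -/
theorem Γ.hom_ext {M : Type*} [Monoid M] {f g : Γ →* M} (h0 : f R0 = g R0) (h1 : f R1 = g R1)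
    (h2 : f R2 = g R2) : f = g := by
  apply Monoid.Coprod.hom_ext
  · refine MonoidHom.ext fun x => ?_
    obtain rfl | rfl | rfl | rfl : x = 1 ∨ x = Multiplicative.ofAdd (1, 0) ∨
        x = Multiplicative.ofAdd (0, 1) ∨
        x = Multiplicative.ofAdd (1, 0) * Multiplicative.ofAdd (0, 1) := by
      revert x; decide
    · simp
    · exact h0
    · exact h2
    · rw [map_mul, map_mul]
      exact congrArg₂ (· * ·) h0 h2
  · exact involutionHom_ext h1

/-- The homomorphism from the cyclic group of order two sending its generator to `g`. -/
def involutionHom {G : Type*} [Group G] (g : G) (hg : g * g = 1) :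
    Multiplicative (ZMod 2) →* G where
  toFun x := g ^ (x.toAdd.val)
  map_one' := by simp
  map_mul' x y := by
    have hx : x = 1 ∨ x = Multiplicative.ofAdd 1 := by revert x; decide
    have hy : y = 1 ∨ y = Multiplicative.ofAdd 1 := by revert y; decide
    rcases hx with rfl | rfl <;> rcases hy with rfl | rfl <;> simp [ZMod.val_one]
    rw [show (1 + 1 : ZMod 2) = 0 from rfl, ZMod.val_zero, pow_zero, hg]

@[simp]
theorem involutionHom_ofAdd_one {G : Type*} [Group G] (g : G) (hg : g * g = 1) :
    involutionHom g hg (Multiplicative.ofAdd 1) = g := by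
  simp [involutionHom, ZMod.val_one]

/-- The homomorphism out of `Γ` determined by images of `R0`, `R1`, `R2` satisfying its
defining relations. -/
def Γ.lift {G : Type*} [Group G] (a b c : G) (ha : a * a = 1) (hb : b * b = 1) (hc : c * c = 1)
    (hac : Commute a c) : Γ →* G :=
  Monoid.Coprod.lift
    (((involutionHom a ha).noncommCoprod (involutionHom c hc)
      fun m n => show Commute (involutionHom a ha m) (involutionHom c hc n) from
        hac.pow_pow _ _).comp
        (MulEquiv.prodMultiplicative (ZMod 2) (ZMod 2)).toMonoidHom)
    (involutionHom b hb)

section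

variable {G : Type*} [Group G] {a b c : G} {ha : a * a = 1} {hb : b * b = 1} {hc : c * c = 1}
  {hac : Commute a c}

@[simp]
theorem Γ.lift_R0 : Γ.lift a b c ha hb hc hac R0 = a := by
  simp [Γ.lift, R0, MulEquiv.prodMultiplicative]

@[simp]
theorem Γ.lift_R1 : Γ.lift a b c ha hb hc hac R1 = b := by
  simp [Γ.lift, R1]

@[simp]
theorem Γ.lift_R2 : Γ.lift a b c ha hb hc hac R2 = c := by
  simp [Γ.lift, R2, MulEquiv.prodMultiplicative]

end

theorem R0_mul_self : R0 * R0 = 1 := by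
  rw [R0, ← map_mul, ← map_one Monoid.Coprod.inl]; rfl

theorem R1_mul_self : R1 * R1 = 1 := by
  rw [R1, ← map_mul, ← map_one Monoid.Coprod.inr]; rfl

theorem R2_mul_self : R2 * R2 = 1 := by
  rw [R2, ← map_mul, ← map_one Monoid.Coprod.inl]; rfl

theorem R0_commute_R2 : Commute R0 R2 :=
  (Commute.all _ _).map Monoid.Coprod.inl

/-- The free product `(ℤ/2ℤ) ∗ ℤ`. -/
abbrev TwoExGroup : Type := Monoid.Coprod (Multiplicative (ZMod 2)) (Multiplicative ℤ)

namespace TwoExGroup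

/-- The involutory generator of `(ℤ/2ℤ) ∗ ℤ`. -/
def invol : TwoExGroup := Monoid.Coprod.inl (Multiplicative.ofAdd 1)

/-- The generator of infinite order of `(ℤ/2ℤ) ∗ ℤ`. -/
def shift : TwoExGroup := Monoid.Coprod.inr (Multiplicative.ofAdd 1)

theorem invol_mul_self : invol * invol = 1 := by
  rw [invol, ← map_mul, ← map_one Monoid.Coprod.inl]; rfl

theorem hom_ext {M : Type*} [Monoid M] {f g : TwoExGroup →* M} (h1 : f invol = g invol)
    (h2 : f shift = g shift) : f = g :=
  Monoid.Coprod.hom_ext (involutionHom_ext h1) (MonoidHom.ext_mint h2)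

/-- The homomorphism out of `(ℤ/2ℤ) ∗ ℤ` determined by the images of its generators. -/
def lift {G : Type*} [Group G] (s t : G) (hs : s * s = 1) : TwoExGroup →* G :=
  Monoid.Coprod.lift (involutionHom s hs) (zpowersHom G t)

@[simp]
theorem lift_invol {G : Type*} [Group G] (s t : G) (hs : s * s = 1) :
    lift s t hs invol = s := by
  simp [lift, invol]

@[simp]
theorem lift_shift {G : Type*} [Group G] (s t : G) (hs : s * s = 1) :
    lift s t hs shift = t := by
  simp [lift, shift]

theorem range_lift {G : Type*} [Group G] (s t : G) (hs : s * s = 1) :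
    (lift s t hs).range = Subgroup.closure {s, t} := by
  apply le_antisymm
  · rw [lift, Monoid.Coprod.range_lift, sup_le_iff]
    constructor <;> rintro _ ⟨x, rfl⟩
    · exact pow_mem (Subgroup.subset_closure (by simp)) _
    · exact zpow_mem (Subgroup.subset_closure (by simp)) _
  · rw [Subgroup.closure_le]
    rintro _ (rfl | rfl)
    exacts [⟨invol, by simp⟩, ⟨shift, by simp⟩]

/-- The endomorphism of `(ℤ/2ℤ) ∗ ℤ` fixing the involution and inverting the other generator. -/
def flipHom : TwoExGroup →* TwoExGroup := lift invol shift⁻¹ invol_mul_self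

theorem flipHom_comp_self : flipHom.comp flipHom = .id _ := by
  apply hom_ext <;> simp [flipHom]

/-- The automorphism of `(ℤ/2ℤ) ∗ ℤ` fixing the involution and inverting the other generator. -/
def flip : MulAut TwoExGroup :=
  flipHom.toMulEquiv flipHom flipHom_comp_self flipHom_comp_self

@[simp] theorem flip_invol : flip invol = invol :=
  lift_invol invol shift⁻¹ invol_mul_self

@[simp] theorem flip_shift : flip shift = shift⁻¹ :=
  lift_shift invol shift⁻¹ invol_mul_self

theorem flip_mul_self : flip * flip = 1 :=
  MulEquiv.ext fun x => DFunLike.congr_fun flipHom_comp_self x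

/-- The action of `ℤ/2ℤ` on `(ℤ/2ℤ) ∗ ℤ` through `flip`. -/
abbrev flipAction : Multiplicative (ZMod 2) →* MulAut TwoExGroup :=
  involutionHom flip flip_mul_self

/-- The canonical homomorphism from `(ℤ/2ℤ) ∗ ℤ` to `Γ`. -/
def toΓ : TwoExGroup →* Γ := lift R2 (R0 * R1) R2_mul_self

/-- The homomorphism from `Γ` onto the semidirect product of `(ℤ/2ℤ) ∗ ℤ` by `flip`. -/
def ofΓ : Γ →* TwoExGroup ⋊[flipAction] Multiplicative (ZMod 2) :=
  Γ.lift (SemidirectProduct.inr (Multiplicative.ofAdd 1))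
    (SemidirectProduct.inr (Multiplicative.ofAdd 1) * SemidirectProduct.inl shift)
    (SemidirectProduct.inl invol)
    (by rw [← map_mul, ← map_one SemidirectProduct.inr]; rfl)
    (by ext <;> simp; rfl)
    (by rw [← map_mul, invol_mul_self, map_one])
    (by rw [commute_iff_eq]; ext <;> simp)

theorem ofΓ_toΓ (x : TwoExGroup) : ofΓ (toΓ x) = SemidirectProduct.inl x := by
  suffices h : ofΓ.comp toΓ = SemidirectProduct.inl from DFunLike.congr_fun h x
  apply hom_ext
  · simp [ofΓ, toΓ]
  · simp only [ofΓ, toΓ, MonoidHom.comp_apply, lift_shift, map_mul, Γ.lift_R0, Γ.lift_R1]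
    rw [← mul_assoc, ← map_mul, show Multiplicative.ofAdd (1 : ZMod 2) * Multiplicative.ofAdd 1 = 1
      from rfl, map_one, one_mul]

theorem toΓ_injective : Function.Injective toΓ := fun x y h =>
  SemidirectProduct.inl_injective (by rw [← ofΓ_toΓ, ← ofΓ_toΓ, h])

/-- The inverse of `ofΓ`. -/
def semidirectToΓ : TwoExGroup ⋊[flipAction] Multiplicative (ZMod 2) →* Γ :=
  SemidirectProduct.lift toΓ (involutionHom R0 R0_mul_self) (by
    intro g
    obtain rfl | rfl : g = 1 ∨ g = Multiplicative.ofAdd 1 := by revert g; decide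
    · exact MonoidHom.ext fun x => by simp
    have h0 : R0⁻¹ = R0 := inv_eq_of_mul_eq_one_left R0_mul_self
    have h1 : R1⁻¹ = R1 := inv_eq_of_mul_eq_one_left R1_mul_self
    apply hom_ext
    · simp [toΓ, R0_commute_R2.eq]
    · simp [toΓ, h0, h1, ← mul_assoc, R0_mul_self])

theorem semidirectToΓ_ofΓ (g : Γ) : semidirectToΓ (ofΓ g) = g := by
  suffices h : semidirectToΓ.comp ofΓ = .id _ from DFunLike.congr_fun h g
  apply Γ.hom_ext
  · simp [semidirectToΓ, ofΓ]
  · simp [semidirectToΓ, ofΓ, toΓ, ← mul_assoc, R0_mul_self]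
  · simp [semidirectToΓ, ofΓ, toΓ]

theorem range_toΓ : toΓ.range = (SemidirectProduct.rightHom.comp ofΓ).ker := by
  ext g
  constructor
  · rintro ⟨x, rfl⟩
    simp [MonoidHom.mem_ker, ofΓ_toΓ]
  · intro hg
    have hg' : ofΓ g ∈ (SemidirectProduct.inl : TwoExGroup →* _ ⋊[flipAction] _).range := by
      rwa [SemidirectProduct.range_inl_eq_ker_rightHom]
    obtain ⟨x, hx⟩ := hg'
    refine ⟨x, ?_⟩
    rw [← semidirectToΓ_ofΓ g, ← hx]
    simp [semidirectToΓ]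

theorem index_range_toΓ : toΓ.range.index = 2 := by
  have h : Function.Surjective (SemidirectProduct.rightHom.comp ofΓ) := by
    intro x
    obtain rfl | rfl : x = 1 ∨ x = Multiplicative.ofAdd 1 := by revert x; decide
    · exact ⟨1, map_one _⟩
    · exact ⟨R0, by simp [ofΓ]⟩
  rw [range_toΓ, Subgroup.index_ker, MonoidHom.range_eq_top.mpr h, Subgroup.card_top]
  simp

end TwoExGroup

/-- With `S1 = R2` and `S = R0·R1`, `S1` has order 2, `S` has infinite order, the canonical
homomorphism `(ℤ/2ℤ) ∗ ℤ → Γ` sending the generator of the first factor to `S1` and the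
generator `1` of `ℤ` to `S` is injective, and its image, the subgroup generated by `S1`
and `S`, has index 2 in `Γ`.  (This is the parent group `N(2 ex)` of Graver–Watkins.) -/
theorem stmt_2 :
    orderOf R2 = 2 ∧ ¬ IsOfFinOrder (R0 * R1) ∧
    (∃ φ : Monoid.Coprod (Multiplicative (ZMod 2)) (Multiplicative ℤ) →* Γ,
      φ (Monoid.Coprod.inl (Multiplicative.ofAdd (1 : ZMod 2))) = R2 ∧
      φ (Monoid.Coprod.inr (Multiplicative.ofAdd (1 : ℤ))) = R0 * R1 ∧
      Function.Injective φ ∧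
      φ.range = Subgroup.closure {R2, R0 * R1}) ∧
    (Subgroup.closure {R2, R0 * R1} : Subgroup Γ).index = 2 := by
  have hR2 : R2 ≠ 1 := fun h => by
    have := Monoid.Coprod.inl_injective (h.trans (map_one Monoid.Coprod.inl).symm)
    revert this
    decide
  have hrange := TwoExGroup.range_lift R2 (R0 * R1) R2_mul_self
  refine ⟨orderOf_eq_prime (by rw [sq, R2_mul_self]) hR2, fun h => ?_,
    ⟨TwoExGroup.toΓ, TwoExGroup.lift_invol .., TwoExGroup.lift_shift ..,
      TwoExGroup.toΓ_injective, hrange⟩, hrange ▸ TwoExGroup.index_range_toΓ⟩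
  rw [← TwoExGroup.lift_shift R2 (R0 * R1) R2_mul_self] at h
  have h' := Monoid.Coprod.snd.isOfFinOrder
    (TwoExGroup.toΓ_injective.isOfFinOrder_iff.mp h)
  rw [TwoExGroup.shift, Monoid.Coprod.snd_apply_inr, isOfFinOrder_iff_eq_one] at h'
  revert h'
  decide
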